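/- arXiv:1609.09433 — 2 statements merged into one kernel-verified Lean document; each statement's English description precedes it below -/
import Mathlib

section
/- Let G be a finite split graph with split partition (C, I), let E_S be the set of strong edges in an optimal solution for MaxSTC on G, and let I_W be the set of vertices of I incident to at least one edge of E_S. If every vertex of I_W is non-adjacent to at least three vertices of C in G, then E_S equals the set E(C) of edges of G with both endpoints in C. -/
/-- A strong-weak labeling satisfies the strong triadic closure if for any two strong edges
`{u,v}` and `{v,w}` with `u ≠ w`, the pair `{u,w}` is an edge of `G`. -/
def SatisfiesSTC {V : Type*} (G : SimpleGraph V) (ES : Set (Sym2 V)) : Prop :=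
  ∀ u v w : V, u ≠ w → s(u, v) ∈ ES → s(v, w) ∈ ES → G.Adj u w

/-- In a split graph, an edge not contained in the clique joins a vertex of the
clique to a vertex of the independent set. -/
lemma exists_clique_indep_of_not_subset {V : Type*} {G : SimpleGraph V} {C I : Set V}
    (hunion : C ∪ I = Set.univ) (hI : ∀ u ∈ I, ∀ v ∈ I, ¬G.Adj u v)
    {e : Sym2 V} (he : e ∈ G.edgeSet) (heC : ¬∀ v ∈ e, v ∈ C) :
    ∃ c ∈ C, ∃ w ∈ I, e = s(c, w) := by
  have hCI (x : V) : x ∈ C ∨ x ∈ I := by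
    rw [← Set.mem_union, hunion]
    trivial
  induction e with
  | _ x y =>
    rw [SimpleGraph.mem_edgeSet] at he
    simp only [Sym2.mem_iff, forall_eq_or_imp, forall_eq, not_and_or] at heC
    rcases hCI x with hx | hx
    · exact ⟨x, hx, y, (hCI y).resolve_left (heC.resolve_left (not_not_intro hx)), rfl⟩
    · exact ⟨y, (hCI y).resolve_right fun hy => hI x hx y hy he, x, hx, Sym2.eq_swap⟩

/-- The edges inside a clique satisfy the strong triadic closure. -/
lemma satisfiesSTC_edges_of_isClique {V : Type*} {G : SimpleGraph V} {C : Set V}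
    (hC : G.IsClique C) : SatisfiesSTC G {e ∈ G.edgeSet | ∀ v ∈ e, v ∈ C} :=
  fun u v w huw huv hvw =>
    hC (huv.2 u (Sym2.mem_mk_left u v)) (hvw.2 w (Sym2.mem_mk_right v w)) huw

/-- If every vertex of the independent set incident to a strong edge has at least three
non-neighbors in the clique, then the strong edges leaving the clique number at most two thirds
of the weak edges inside it. -/
lemma three_mul_ncard_diff_le {V : Type*} [Fintype V] {G : SimpleGraph V} {C I : Set V}
    (hunion : C ∪ I = Set.univ) (hdisj : Disjoint C I)
    (hC : G.IsClique C) (hI : ∀ u ∈ I, ∀ v ∈ I, ¬G.Adj u v)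
    {ES : Set (Sym2 V)} (hsub : ES ⊆ G.edgeSet) (hstc : SatisfiesSTC G ES)
    (hIW : ∀ v ∈ I, (∃ e ∈ ES, v ∈ e) → 3 ≤ {c ∈ C | ¬G.Adj v c}.ncard) :
    (ES \ {e ∈ G.edgeSet | ∀ v ∈ e, v ∈ C}).ncard * 3 ≤
      ({e ∈ G.edgeSet | ∀ v ∈ e, v ∈ C} \ ES).ncard * 2 := by
  classical
  set EC : Set (Sym2 V) := {e ∈ G.edgeSet | ∀ v ∈ e, v ∈ C}
  have hsplit : ∀ e ∈ ES \ EC, ∃ c ∈ C, ∃ w ∈ I, e = s(c, w) := fun e he =>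
    exists_clique_indep_of_not_subset hunion hI (hsub he.1) fun h => he.2 ⟨hsub he.1, h⟩
  have hunique : ∀ c ∈ C, ∀ e ∈ ES \ EC, ∀ e' ∈ ES \ EC, c ∈ e → c ∈ e' → e = e' := by
    have hform : ∀ c ∈ C, ∀ e ∈ ES \ EC, c ∈ e → ∃ w ∈ I, e = s(c, w) := by
      intro c hc e he hce
      obtain ⟨c', -, w, hw, rfl⟩ := hsplit e he
      rcases Sym2.mem_iff.1 hce with rfl | rfl
      · exact ⟨w, hw, rfl⟩
      · exact (Set.disjoint_left.1 hdisj hc hw).elim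
    intro c hc e he e' he' hce hce'
    obtain ⟨w, hw, rfl⟩ := hform c hc e he hce
    obtain ⟨w', hw', rfl⟩ := hform c hc e' he' hce'
    by_contra hne
    refine hI w hw w' hw' (hstc w c w' (fun h => hne (by rw [h])) ?_ he'.1)
    rw [Sym2.eq_swap]
    exact he.1
  rw [Set.ncard_eq_toFinset_card', Set.ncard_eq_toFinset_card']
  refine Finset.card_mul_le_card_mul (fun e k => ∃ c, c ∈ e ∧ c ∈ k) ?_ ?_
  · intro e he
    rw [Set.mem_toFinset] at he
    obtain ⟨c, hc, w, hw, rfl⟩ := hsplit e he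
    have hcw : G.Adj c w := hsub he.1
    refine (hIW w hw ⟨_, he.1, Sym2.mem_mk_right c w⟩).trans ?_
    rw [Set.ncard_eq_toFinset_card']
    refine Finset.card_le_card_of_injOn (fun b => s(c, b)) ?_ ?_
    · intro b hb
      simp only [Finset.mem_coe, Set.mem_toFinset, Set.mem_ofPred_eq] at hb
      obtain ⟨hbC, hwb⟩ := hb
      have hcb : c ≠ b := by
        rintro rfl
        exact hwb hcw.symm
      simp only [Finset.mem_coe, Finset.mem_bipartiteAbove, Set.mem_toFinset]
      refine ⟨⟨⟨hC hc hbC hcb, ?_⟩, fun hES => hwb (hstc w c b ?_ ?_ hES)⟩,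
        c, Sym2.mem_mk_left c w, Sym2.mem_mk_left c b⟩
      · simp [hc, hbC]
      · rintro rfl
        exact Set.disjoint_left.1 hdisj hbC hw
      · rw [Sym2.eq_swap]
        exact he.1
    · intro b _ b' _ h
      exact Sym2.congr_right.1 h
  · intro k hk
    rw [Set.mem_toFinset] at hk
    induction k with
    | _ a b =>
      have hone : ∀ c ∈ C, ((ES \ EC).toFinset.filter (c ∈ ·)).card ≤ 1 := by
        intro c hc
        refine Finset.card_le_one.2 fun e he e' he' => ?_
        simp only [Finset.mem_filter, Set.mem_toFinset] at he he'
        exact hunique c hc e he.1 e' he'.1 he.2 he'.2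
      have ha := hone a (hk.1.2 a (Sym2.mem_mk_left a b))
      have hb := hone b (hk.1.2 b (Sym2.mem_mk_right a b))
      refine (Finset.card_le_card ?_).trans ((Finset.card_union_le _ _).trans (add_le_add ha hb))
      intro e he
      rw [Finset.mem_bipartiteBelow] at he
      obtain ⟨heF, c, hce, hck⟩ := he
      rw [Finset.mem_union, Finset.mem_filter, Finset.mem_filter]
      rcases Sym2.mem_iff.1 hck with rfl | rfl
      · exact Or.inl ⟨heF, hce⟩
      · exact Or.inr ⟨heF, hce⟩

/-- Let `G` be a finite split graph with split partition `(C, I)`, let `ES`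
be the set of strong edges in an optimal solution for MaxSTC on `G`, and let `I_W` be the set
of vertices of `I` incident to at least one edge of `ES`.  If every vertex of `I_W` is
non-adjacent to at least three vertices of `C` in `G`, then `ES` equals the set `E(C)` of
edges of `G` with both endpoints in `C`. -/
theorem stmt_2 {V : Type*} [Fintype V] (G : SimpleGraph V) (C I : Set V)
    (hunion : C ∪ I = Set.univ) (hdisj : Disjoint C I)
    (hC : G.IsClique C) (hI : ∀ u ∈ I, ∀ v ∈ I, ¬G.Adj u v)
    (ES : Set (Sym2 V)) (hsub : ES ⊆ G.edgeSet)
    (hstc : SatisfiesSTC G ES)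
    (hopt : ∀ S : Set (Sym2 V), S ⊆ G.edgeSet → SatisfiesSTC G S → S.ncard ≤ ES.ncard)
    (hIW : ∀ v ∈ I, (∃ e ∈ ES, v ∈ e) → 3 ≤ {c ∈ C | ¬G.Adj v c}.ncard) :
    ES = {e ∈ G.edgeSet | ∀ v ∈ e, v ∈ C} := by
  have hcount := three_mul_ncard_diff_le hunion hdisj hC hI hsub hstc hIW
  have hmax := hopt _ (fun e he => he.1) (satisfiesSTC_edges_of_isClique hC)
  have hdiff := Set.ncard_le_ncard_iff_ncard_sdiff_le_ncard_sdiff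
    (s := {e ∈ G.edgeSet | ∀ v ∈ e, v ∈ C}) (t := ES) |>.1 hmax
  refine Set.Subset.antisymm ?_ ?_ <;> rw [← Set.sdiff_eq_empty, ← Set.ncard_eq_zero] <;> omega
end

section
/- Let G be a finite split graph with split partition (C, I), let E_S be the set of strong edges in an optimal solution for MaxSTC on G, and let I_W be the set of vertices of I incident to at least one edge of E_S. If every vertex of I_W is non-adjacent to exactly one vertex of C in G, then |E_S| ≤ |E(C)| + ⌊|I_W|/2⌋. -/
/-- Along `c ↦ s(c, f c)` two elements can only be identified when `f` swaps them, so the number of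
identified pairs is at most half the number of elements lying on a 2-cycle of `f`. -/
theorem two_mul_card_le_card_image_sym2 {V : Type*} [DecidableEq V] (K : Finset V) (f : V → V) :
    2 * K.card ≤ 2 * (K.image fun c => s(c, f c)).card
      + (K.filter fun c => f c ∈ K ∧ f (f c) = c ∧ f c ≠ c).card := by
  set D := K.filter fun c => f c ∈ K ∧ f (f c) = c ∧ f c ≠ c with hD
  set g : V → Sym2 V := fun c => s(c, f c) with hg
  have hDK : ∀ x ∈ D, g x ∈ K.image g := fun x hx =>
    Finset.mem_image_of_mem g (Finset.mem_filter.1 hx).1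
  rw [Finset.card_eq_sum_card_image g K, Finset.card_eq_sum_card_fiberwise hDK,
    Finset.card_eq_sum_ones (K.image g), Finset.mul_sum, Finset.mul_sum,
    ← Finset.sum_add_distrib]
  refine Finset.sum_le_sum fun e _ => ?_
  by_cases h1 : (K.filter fun c => g c = e).card ≤ 1
  · lia
  have hsub : (K.filter fun c => g c = e) ⊆ D.filter fun c => g c = e := by
    intro c hc
    obtain ⟨d, hd, hdc⟩ := Finset.exists_mem_ne (not_le.1 h1) c
    simp only [hD, hg, Finset.mem_filter] at hc hd ⊢
    have h := hd.2.trans hc.2.symm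
    rw [Sym2.eq_iff] at h
    grind
  have h2 : (K.filter fun c => g c = e).card ≤ 2 := by
    induction e with | _ x y
    refine (Finset.card_le_card (t := {x, y}) fun c hc => ?_).trans Finset.card_le_two
    have h := (Finset.mem_filter.1 hc).2
    simp only [hg, Sym2.eq_iff] at h
    grind
  have := Finset.card_le_card hsub
  lia

/-- Let `G` be a finite split graph with split partition `(C, I)`, let `ES`
be the set of strong edges in an optimal solution for MaxSTC on `G`, and let `I_W` be the set
of vertices of `I` incident to at least one edge of `ES`.  If every vertex of `I_W` is
non-adjacent to exactly one vertex of `C` in `G`, then `|ES| ≤ |E(C)| + ⌊|I_W|/2⌋`. -/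
theorem stmt_3 {V : Type*} [Fintype V] (G : SimpleGraph V) (C I : Set V)
    (hunion : C ∪ I = Set.univ) (hdisj : Disjoint C I)
    (hC : G.IsClique C) (hI : ∀ u ∈ I, ∀ v ∈ I, ¬G.Adj u v)
    (ES : Set (Sym2 V)) (hsub : ES ⊆ G.edgeSet)
    (hstc : SatisfiesSTC G ES)
    (hopt : ∀ S : Set (Sym2 V), S ⊆ G.edgeSet → SatisfiesSTC G S → S.ncard ≤ ES.ncard)
    (hIW : ∀ v ∈ I, (∃ e ∈ ES, v ∈ e) → {c ∈ C | ¬G.Adj v c}.ncard = 1) :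
    ES.ncard ≤ {e ∈ G.edgeSet | ∀ v ∈ e, v ∈ C}.ncard
      + {v ∈ I | ∃ e ∈ ES, v ∈ e}.ncard / 2 := by
  classical
  set A : Set (Sym2 V) := {e ∈ G.edgeSet | ∀ v ∈ e, v ∈ C} with hA
  set W : Set V := {v ∈ I | ∃ e ∈ ES, v ∈ e} with hW
  have hCI : ∀ v, v ∉ I → v ∈ C := fun v hv =>
    ((Set.eq_univ_iff_forall.1 hunion v).resolve_right hv)
  set K : Finset V := Finset.univ.filter fun c => c ∈ C ∧ ∃ w ∈ I, s(w, c) ∈ ES with hK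
  have hown : ∀ c, ∃ w, c ∈ K → w ∈ I ∧ s(w, c) ∈ ES := by
    intro c
    by_cases hc : c ∈ K
    · obtain ⟨w, hw⟩ := (Finset.mem_filter.1 hc).2.2
      exact ⟨w, fun _ => hw⟩
    · exact ⟨c, fun h => absurd h hc⟩
  choose o ho using hown
  have hnon : ∀ w, ∃ b, w ∈ W → b ∈ C ∧ ¬G.Adj w b := by
    intro w
    by_cases hw : w ∈ W
    · have h := hIW w hw.1 hw.2
      obtain ⟨b, hb⟩ := Set.ncard_eq_one.1 h
      exact ⟨b, fun _ => (hb.symm ▸ Set.mem_singleton b : b ∈ {c ∈ C | ¬G.Adj w c})⟩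
    · exact ⟨w, fun h => absurd h hw⟩
  choose b hb using hnon
  have hoW : ∀ c ∈ K, o c ∈ W := fun c hc =>
    ⟨(ho c hc).1, _, (ho c hc).2, Sym2.mem_mk_left _ _⟩
  have hKC : ∀ c ∈ K, c ∈ C := fun c hc => (Finset.mem_filter.1 hc).2.1
  have hne : ∀ c ∈ K, c ≠ b (o c) := by
    intro c hc h
    have h' := (hb _ (hoW c hc)).2
    rw [← h] at h'
    exact h' (hsub (ho c hc).2)
  have hcross : (ES \ A).ncard ≤ K.card := by
    have hss : ES \ A ⊆ ((K.image fun c => s(o c, c) : Finset (Sym2 V)) : Set (Sym2 V)) := by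
      have key : ∀ w c, w ∈ I → s(w, c) ∈ ES → ∃ d ∈ K, s(o d, d) = s(w, c) := by
        intro w c hw hwc
        have hc : c ∈ K := Finset.mem_filter.2
          ⟨Finset.mem_univ _, hCI c fun hcI => hI w hw c hcI (hsub hwc), w, hw, hwc⟩
        refine ⟨c, hc, ?_⟩
        by_contra hcon
        have hcw : s(c, w) ∈ ES := Sym2.eq_swap ▸ hwc
        exact hI _ (ho c hc).1 _ hw
          (hstc (o c) c w (fun h => hcon (by rw [h])) (ho c hc).2 hcw)
      rintro e ⟨he, heA⟩
      induction e with | _ x y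
      simp only [Finset.coe_image, Set.mem_image, Finset.mem_coe]
      by_cases hx : x ∈ I
      · exact key x y hx he
      by_cases hy : y ∈ I
      · rw [Sym2.eq_swap] at he ⊢
        exact key y x hy he
      · refine absurd ⟨hsub he, fun v hv => ?_⟩ heA
        rcases Sym2.mem_iff.1 hv with rfl | rfl
        exacts [hCI _ hx, hCI _ hy]
    refine (Set.ncard_le_ncard hss).trans ?_
    rw [Set.ncard_coe_finset]
    exact Finset.card_image_le
  have hweak : (K.image fun c => s(c, b (o c))).card ≤ (A \ ES).ncard := by
    rw [← Set.ncard_coe_finset]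
    refine Set.ncard_le_ncard fun e he => ?_
    simp only [Finset.coe_image, Set.mem_image, Finset.mem_coe] at he
    obtain ⟨c, hc, rfl⟩ := he
    obtain ⟨hbC, hbadj⟩ := hb _ (hoW c hc)
    refine ⟨⟨hC (hKC c hc) hbC (hne c hc), fun v hv => ?_⟩, fun hES => hbadj ?_⟩
    · rcases Sym2.mem_iff.1 hv with rfl | rfl
      exacts [hKC _ hc, hbC]
    · exact hstc _ c _ (fun h => Set.disjoint_left.1 hdisj hbC (h ▸ (ho c hc).1))
        (ho c hc).2 hES
  have hswap : (K.filter fun c => b (o c) ∈ K ∧ b (o (b (o c))) = c ∧ b (o c) ≠ c).card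
      ≤ W.ncard := by
    rw [← Set.ncard_coe_finset]
    refine Set.ncard_le_ncard_of_injOn o (fun c hc => hoW c (Finset.mem_filter.1 hc).1) ?_
    intro c hc d hd hcd
    have hc' := (Finset.mem_filter.1 hc).2.2.1
    have hd' := (Finset.mem_filter.1 hd).2.2.1
    rw [← hc', ← hd', hcd]
  have hcount := two_mul_card_le_card_image_sym2 K fun c => b (o c)
  have h1 := Set.ncard_inter_add_ncard_sdiff_eq_ncard ES A
  have h2 := Set.ncard_inter_add_ncard_sdiff_eq_ncard A ES
  rw [Set.inter_comm] at h2
  lia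
end
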